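/- Let Σ be a positive definite real matrix indexed by a finite set V with K = Σ⁻¹. Then for every pair of distinct x, y ∈ V, the networked partial covariance ω_{xy·V\{x,y}} = σ_{xy·V\{x,y}} / (1 − ρ²_{{x,y}:V\{x,y}}) has the same sign as the partial covariance σ_{xy·V\{x,y}} (in particular it is zero if and only if σ_{xy·V\{x,y}} is zero) and satisfies |ω_{xy·V\{x,y}}| ≥ |σ_{xy·V\{x,y}}|. -/

import Mathlib

open Matrix BigOperators

variable {V : Type*} [Fintype V] [DecidableEq V]

/-- Submatrix of `M` with rows indexed by `A` and columns indexed by `B`. -/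
def subm (M : Matrix V V ℝ) (A B : Finset V) : Matrix A B ℝ :=
  M.submatrix (fun i => (i : V)) (fun j => (j : V))

/-- Partial covariance matrix `Σ_{AA·B} = Σ_AA − Σ_AB (Σ_BB)⁻¹ Σ_BA`. -/
noncomputable def pcov (M : Matrix V V ℝ) (A B : Finset V) : Matrix A A ℝ :=
  subm M A A - subm M A B * (subm M B B)⁻¹ * subm M B A

/-- A matrix `K` indexed by `W` implies a graph `G` on `W` if every nonzero
off-diagonal entry of `K` corresponds to an edge of `G`. -/
def MatImplies {W : Type*} (K : Matrix W W ℝ) (G : SimpleGraph W) : Prop :=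
  ∀ u v : W, u ≠ v → K u v ≠ 0 → G.Adj u v

/-- Path weight `ω(π, Γ) = (−1)^{|P|+1} det(Γ_PP) ∏_{{u,v} ∈ E(π)} (Γ⁻¹)_uv`. -/
noncomputable def pathWeight {G : SimpleGraph V} {x y : V} (M : Matrix V V ℝ) (p : G.Walk x y) : ℝ :=
  (-1 : ℝ) ^ (p.support.toFinset.card + 1)
    * (subm M p.support.toFinset p.support.toFinset).det
    * (p.darts.map (fun d => M⁻¹ d.toProd.1 d.toProd.2)).prod

/-- Vector alienation coefficient `λ_{A:B}`. -/
noncomputable def alien (M : Matrix V V ℝ) (A B : Finset V) : ℝ :=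
  (subm M (A ∪ B) (A ∪ B)).det / ((subm M A A).det * (subm M B B).det)

/-- Squared vector correlation `ρ²_{A:B} = 1 − λ_{A:B}`. -/
noncomputable def rho2 (M : Matrix V V ℝ) (A B : Finset V) : ℝ :=
  1 - alien M A B

/-- Partial vector alienation coefficient `λ_{A:B|C}`. -/
noncomputable def alienCond (M : Matrix V V ℝ) (A B C : Finset V) : ℝ :=
  (pcov M (A ∪ B) C).det / ((pcov M A C).det * (pcov M B C).det)

/-- Squared partial vector correlation `ρ²_{A:B|C}`, with the convention that it
is `0` whenever `A = ∅` or `B = ∅`. -/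
noncomputable def rho2Cond (M : Matrix V V ℝ) (A B C : Finset V) : ℝ :=
  if A = ∅ ∨ B = ∅ then 0 else 1 - alienCond M A B C

/-- The limited-order networked partial covariance
`ω_{xy·Q} = ω(⟨x,y⟩, Σ_{(Q∪{x,y})(Q∪{x,y})})
          = (−1) · det(Σ_{{x,y}{x,y}}) · ((Σ_{(Q∪{x,y})(Q∪{x,y})})⁻¹)_{xy}`. -/
noncomputable def npcov (M : Matrix V V ℝ) (Q : Finset V) (x y : V) : ℝ :=
  (-1 : ℝ) * (subm M {x, y} {x, y}).det *
    (subm M (Q ∪ {x, y}) (Q ∪ {x, y}))⁻¹ ⟨x, by simp⟩ ⟨y, by simp⟩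

lemma det2_le_add (P Q : Matrix (Fin 2) (Fin 2) ℝ) (hP : P.PosSemidef) (hQ : Q.PosSemidef) :
    P.det ≤ (P+Q).det := by
  have p1 := hP.det_nonneg
  have q1 := hQ.det_nonneg
  have p2 := hP.diag_nonneg (i := 0)
  have p3 := hP.diag_nonneg (i := 1)
  have q2 := hQ.diag_nonneg (i := 0)
  have q3 := hQ.diag_nonneg (i := 1)
  have p4 := hP.isHermitian.apply 0 1
  have q4 := hQ.isHermitian.apply 0 1
  simp only [det_fin_two, star_trivial, Matrix.add_apply] at *
  rw [p4] at p1 ⊢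
  rw [q4] at q1 ⊢
  clear p4 q4
  generalize P 0 0 = a at *
  generalize P 0 1 = b at *
  generalize P 1 1 = c at *
  generalize Q 0 0 = d at *
  generalize Q 0 1 = e at *
  generalize Q 1 1 = f at *
  have h : (2*(b*e))^2 ≤ (a*f+c*d)^2 := by
    have : b*b*(e*e) ≤ a*c*(d*f) :=
      mul_le_mul (by linarith) (by linarith) (mul_self_nonneg _) (by positivity)
    nlinarith [sq_nonneg (a*f-c*d)]
  have h2 := (abs_le.1 (abs_le_of_sq_le_sq h (by positivity))).2
  nlinarith

lemma subm_posDef (S : Matrix V V ℝ) (hS : S.PosDef) (A : Finset V) : (subm S A A).PosDef :=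
  hS.submatrix Subtype.val_injective

lemma subm_conjT (S : Matrix V V ℝ) (hS : S.PosDef) (A B : Finset V) :
    subm S B A = (subm S A B)ᴴ := by
  ext i j
  exact (hS.isHermitian.apply _ _).symm

lemma alien_bounds (S : Matrix V V ℝ) (hS : S.PosDef) (x y : V) (hxy : x ≠ y) :
    0 < alien S {x, y} ({x, y} : Finset V)ᶜ ∧ alien S {x, y} ({x, y} : Finset V)ᶜ ≤ 1 := by
  have hc : Fintype.card (({x, y} : Finset V) : Type _) = 2 := by
    rw [Fintype.card_coe, Finset.card_pair hxy]
  have ee : Fin 2 ≃ (({x, y} : Finset V) : Type _) := (Fintype.equivFinOfCardEq hc).symm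
  generalize ({x, y} : Finset V) = A at *
  have hd : Disjoint A Aᶜ := disjoint_compl_right
  generalize Aᶜ = B at *
  have hA := subm_posDef S hS A
  have hB := subm_posDef S hS B
  have hU := subm_posDef S hS (A ∪ B)
  have hAd := hA.det_pos
  have hBd := hB.det_pos
  have hUd := hU.det_pos
  refine ⟨div_pos hUd (mul_pos hAd hBd), ?_⟩
  unfold alien
  rw [div_le_one (mul_pos hAd hBd)]
  have hblock : (subm S (A ∪ B) (A ∪ B)).submatrix (Equiv.Finset.union A B hd)
      (Equiv.Finset.union A B hd) =
      fromBlocks (subm S A A) (subm S A B) (subm S A B)ᴴ (subm S B B) := by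
    rw [← subm_conjT S hS]
    ext i j
    rcases i with i | i <;> rcases j with j | j <;> rfl
  letI : Invertible (subm S B B) := (subm S B B).invertibleOfIsUnitDet (isUnit_iff_ne_zero.2 hBd.ne')
  have hps := (PosDef.fromBlocks₂₂ (subm S A A) (subm S A B) hB).1
    (hblock ▸ (hU.posSemidef.submatrix _))
  have hq := hB.inv.posSemidef.mul_mul_conjTranspose_same (subm S A B)
  have hdet := congrArg Matrix.det hblock
  rw [det_submatrix_equiv_self, det_fromBlocks₂₂, invOf_eq_nonsing_inv] at hdet
  have key := det2_le_add _ _ (hps.submatrix ee) (hq.submatrix ee)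
  have hadd : ∀ P Q : Matrix A A ℝ,
      P.submatrix ee ee + Q.submatrix ee ee = (P + Q).submatrix ee ee := fun _ _ => rfl
  rw [hadd, sub_add_cancel, det_submatrix_equiv_self, det_submatrix_equiv_self] at key
  rw [hdet, mul_comm]
  exact mul_le_mul_of_nonneg_right key hBd.le

/-- the networked partial covariance has the same sign as the partial
covariance and is at least as large in absolute value. -/
theorem npcov_same_sign_and_inflation
    (S K : Matrix V V ℝ) (hS : S.PosDef) (hK : K = S⁻¹)
    (x y : V) (hxy : x ≠ y) :
    (0 < pcov S {x, y} ({x, y} : Finset V)ᶜ ⟨x, by simp⟩ ⟨y, by simp⟩ →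
      0 < pcov S {x, y} ({x, y} : Finset V)ᶜ ⟨x, by simp⟩ ⟨y, by simp⟩
        / (1 - rho2 S {x, y} ({x, y} : Finset V)ᶜ)) ∧
    (pcov S {x, y} ({x, y} : Finset V)ᶜ ⟨x, by simp⟩ ⟨y, by simp⟩ < 0 →
      pcov S {x, y} ({x, y} : Finset V)ᶜ ⟨x, by simp⟩ ⟨y, by simp⟩
        / (1 - rho2 S {x, y} ({x, y} : Finset V)ᶜ) < 0) ∧
    (pcov S {x, y} ({x, y} : Finset V)ᶜ ⟨x, by simp⟩ ⟨y, by simp⟩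
        / (1 - rho2 S {x, y} ({x, y} : Finset V)ᶜ) = 0 ↔
      pcov S {x, y} ({x, y} : Finset V)ᶜ ⟨x, by simp⟩ ⟨y, by simp⟩ = 0) ∧
    |pcov S {x, y} ({x, y} : Finset V)ᶜ ⟨x, by simp⟩ ⟨y, by simp⟩|
      ≤ |pcov S {x, y} ({x, y} : Finset V)ᶜ ⟨x, by simp⟩ ⟨y, by simp⟩
          / (1 - rho2 S {x, y} ({x, y} : Finset V)ᶜ)| := by
  obtain ⟨h0, h1⟩ := alien_bounds S hS x y hxy
  have hr : 1 - rho2 S {x, y} ({x, y} : Finset V)ᶜ = alien S {x, y} ({x, y} : Finset V)ᶜ := by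
    unfold rho2; ring
  rw [hr]
  refine ⟨fun h => div_pos h h0, fun h => div_neg_of_neg_of_pos h h0, ?_, ?_⟩
  · rw [div_eq_zero_iff]
    exact ⟨fun h => h.resolve_right h0.ne', Or.inl⟩
  · rw [abs_div, abs_of_pos h0]
    exact le_div_self (abs_nonneg _) h0 h1
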